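/- arXiv:1203.2322 — 3 statements merged into one kernel-verified Lean document; each statement's English description precedes it below -/
import Mathlib

section
/- Let [a,b] ⊂ ℝ be a compact interval and E a non-empty subset of [a,b]. If a function f : [a,b] → ℝ is totally Kurzweil–Henstock integrable to the value ℑ on [a,b], witnessed by a nontrivial interval function Φ, and Φ is basically summable to the sum ℜ on E, then f is Kurzweil–Henstock integrable on [a,b] with KH-∫_a^b f = ℑ − ℜ; that is, KH-vt∫_a^b f = KH-∫_a^b f + ℜ. -/
/-- A tagged partition `P = {([aᵢ, bᵢ], xᵢ)}` of a compact interval `[a, b]`, given by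
division points `a = c 0 < c 1 < ⋯ < c ν = b` together with tags `t i ∈ [c i, c (i+1)]`. -/
structure TaggedPartition (a b : ℝ) where
  ν : ℕ
  c : Fin (ν + 1) → ℝ
  t : Fin ν → ℝ
  mono : StrictMono c
  first : c 0 = a
  last : c (Fin.last ν) = b
  tag_mem : ∀ i : Fin ν, t i ∈ Set.Icc (c i.castSucc) (c i.succ)

/-- `δ` is a gauge on `[a, b]`: it is positive at each point of `[a, b]`. -/
def IsGauge (a b : ℝ) (δ : ℝ → ℝ) : Prop :=
  ∀ x ∈ Set.Icc a b, 0 < δ x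

/-- `P` is `δ`-fine: each `[aᵢ, bᵢ]` is contained in `(xᵢ - δ xᵢ, xᵢ + δ xᵢ)`. -/
def TaggedPartition.IsFine {a b : ℝ} (P : TaggedPartition a b) (δ : ℝ → ℝ) : Prop :=
  ∀ i : Fin P.ν, Set.Icc (P.c i.castSucc) (P.c i.succ) ⊆
    Set.Ioo (P.t i - δ (P.t i)) (P.t i + δ (P.t i))

/-- The Riemann sum `Ξ_f(P) = Σᵢ f (xᵢ) (bᵢ - aᵢ)`. -/
def riemannSum {a b : ℝ} (f : ℝ → ℝ) (P : TaggedPartition a b) : ℝ :=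
  ∑ i : Fin P.ν, f (P.t i) * (P.c i.succ - P.c i.castSucc)

/-- The sum `Σ_Φ(P) = Σᵢ Φ([aᵢ, bᵢ])` of an interval function `Φ`
(an interval function is recorded as a function of the two endpoints). -/
def intervalSum {a b : ℝ} (Φ : ℝ → ℝ → ℝ) (P : TaggedPartition a b) : ℝ :=
  ∑ i : Fin P.ν, Φ (P.c i.castSucc) (P.c i.succ)

open Classical in
/-- The restricted sum `Σ_Φ(P|_E)`, over the interval-point pairs of `P` whose tag lies
in `E`. -/
noncomputable def intervalSumOn {a b : ℝ} (Φ : ℝ → ℝ → ℝ) (P : TaggedPartition a b)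
    (E : Set ℝ) : ℝ :=
  ∑ i : Fin P.ν, if P.t i ∈ E then Φ (P.c i.castSucc) (P.c i.succ) else 0

/-- `f` is Kurzweil–Henstock integrable to `A` on `[a, b]`. -/
def KHIntegralTo (a b : ℝ) (f : ℝ → ℝ) (A : ℝ) : Prop :=
  ∀ ε > 0, ∃ δ : ℝ → ℝ, IsGauge a b δ ∧
    ∀ P : TaggedPartition a b, P.IsFine δ → |riemannSum f P - A| < ε

/-- `f` is totally Kurzweil–Henstock integrable to `I` on `[a, b]` (relative to the
exceptional set `E`), witnessed by the interval function `Φ`: for every `ε > 0` there is a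
gauge `δ` such that `|Ξ_f(P) - Σ_Φ(P|_{[a,b] \ E})| < ε` and `Σ_Φ(P) = I` for every
`δ`-fine tagged partition `P` of `[a, b]`. -/
def TotalKHIntegralWith (a b : ℝ) (E : Set ℝ) (f : ℝ → ℝ) (Φ : ℝ → ℝ → ℝ) (I : ℝ) : Prop :=
  ∀ ε > 0, ∃ δ : ℝ → ℝ, IsGauge a b δ ∧
    ∀ P : TaggedPartition a b, P.IsFine δ →
      |riemannSum f P - intervalSumOn Φ P (Set.Icc a b \ E)| < ε ∧ intervalSum Φ P = I

/-- The interval function `Φ` is basically summable (BS) to the sum `R` on `E ⊆ [a, b]`. -/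
def BasicallySummable (a b : ℝ) (E : Set ℝ) (Φ : ℝ → ℝ → ℝ) (R : ℝ) : Prop :=
  ∀ ε > 0, ∃ δ : ℝ → ℝ, IsGauge a b δ ∧
    ∀ P : TaggedPartition a b, P.IsFine δ → |intervalSumOn Φ P E - R| < ε

theorem TaggedPartition.tag_mem_Icc {a b : ℝ} (P : TaggedPartition a b) (i : Fin P.ν) :
    P.t i ∈ Set.Icc a b := by
  have h := P.tag_mem i
  have hl : P.c 0 ≤ P.c i.castSucc := P.mono.monotone (Fin.zero_le _)
  have hr : P.c i.succ ≤ P.c (Fin.last P.ν) := P.mono.monotone (Fin.le_last _)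
  rw [P.first] at hl
  rw [P.last] at hr
  exact ⟨hl.trans h.1, h.2.trans hr⟩

theorem TaggedPartition.IsFine.mono {a b : ℝ} {P : TaggedPartition a b} {δ δ' : ℝ → ℝ}
    (hP : P.IsFine δ) (h : ∀ x, δ x ≤ δ' x) : P.IsFine δ' := fun i =>
  (hP i).trans <| Set.Ioo_subset_Ioo (by linarith [h (P.t i)]) (by linarith [h (P.t i)])

theorem intervalSumOn_diff_add_intervalSumOn {a b : ℝ} (Φ : ℝ → ℝ → ℝ)
    (P : TaggedPartition a b) (E : Set ℝ) :
    intervalSumOn Φ P (Set.Icc a b \ E) + intervalSumOn Φ P E = intervalSum Φ P := by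
  unfold intervalSumOn intervalSum
  rw [← Finset.sum_add_distrib]
  refine Finset.sum_congr rfl fun i _ => ?_
  by_cases h : P.t i ∈ E <;> simp only [Set.mem_sdiff, P.tag_mem_Icc i, h] <;> simp

/-- Lemma 1. If `f` is totally Kurzweil–Henstock integrable to `I` on
`[a, b]` witnessed by a nontrivial interval function `Φ`, and `Φ` is basically summable to
`R` on the nonempty exceptional set `E`, then `f` is Kurzweil–Henstock integrable on
`[a, b]` with `KH-∫ f = I - R`, i.e. `KH-vt∫ f = KH-∫ f + R`. -/
theorem totalKH_eq_KH_add_residue (a b : ℝ) (hab : a < b) (E : Set ℝ)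
    (hE : E ⊆ Set.Icc a b) (hEne : E.Nonempty) (f : ℝ → ℝ) (Φ : ℝ → ℝ → ℝ)
    (hΦ : ∃ u v, Φ u v ≠ 0) (I R : ℝ)
    (htot : TotalKHIntegralWith a b E f Φ I)
    (hbs : BasicallySummable a b E Φ R) :
    KHIntegralTo a b f (I - R) := by
  intro ε hε
  obtain ⟨δ₁, hδ₁, h₁⟩ := htot (ε / 2) (half_pos hε)
  obtain ⟨δ₂, hδ₂, h₂⟩ := hbs (ε / 2) (half_pos hε)
  refine ⟨fun x => min (δ₁ x) (δ₂ x), fun x hx => lt_min (hδ₁ x hx) (hδ₂ x hx), fun P hP => ?_⟩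
  obtain ⟨hf, hI⟩ := h₁ P (hP.mono fun x => min_le_left _ _)
  have hR := h₂ P (hP.mono fun x => min_le_right _ _)
  have hsum := intervalSumOn_diff_add_intervalSumOn Φ P E
  rw [abs_lt] at hf hR ⊢
  constructor <;> linarith
end

section
/- Let a < 0 < b and let F : [a,b] → ℝ be the Heaviside unit function, F(x) = 0 for a ≤ x ≤ 0 and F(x) = 1 for 0 < x ≤ b. Then the identically zero function on [a,b] (which equals D_exF for E = {0}) is totally Kurzweil–Henstock integrable on [a,b] with KH-vt∫_a^b D_exF = 1, the witnessing interval function being the associated interval function Φ([u,v]) = F(v) − F(u) of F. -/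
theorem intervalSumOn_eq_zero {a b : ℝ} {Φ : ℝ → ℝ → ℝ} {P : TaggedPartition a b} {E : Set ℝ}
    (h : ∀ i, P.t i ∈ E → Φ (P.c i.castSucc) (P.c i.succ) = 0) : intervalSumOn Φ P E = 0 := by
  refine Finset.sum_eq_zero fun i _ => ?_
  split_ifs with hi
  exacts [h i hi, rfl]

theorem TaggedPartition.intervalSum_sub {a b : ℝ} (P : TaggedPartition a b) (F : ℝ → ℝ) :
    intervalSum (fun u v => F v - F u) P = F b - F a := by
  have h := (Fin.sum_univ_succ fun i => F (P.c i)).symm.trans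
    (Fin.sum_univ_castSucc fun i => F (P.c i))
  rw [P.first, P.last] at h
  simp only [intervalSum, Finset.sum_sub_distrib]
  linarith

open Classical in
/-- For the Heaviside unit function `F` (`F x = 0` for `x ≤ 0`,
`F x = 1` for `x > 0`) on `[a, b]` with `a < 0 < b`, the identically zero function
(`= D_ex F` for `E = {0}`) is totally Kurzweil–Henstock integrable on `[a, b]` to `1`,
witnessed by the associated interval function of `F`. -/
theorem heaviside_totalKH (a b : ℝ) (ha : a < 0) (hb : 0 < b) :
    TotalKHIntegralWith a b {0} (fun _ => 0)
      (fun u v => (if 0 < v then (1 : ℝ) else 0) - (if 0 < u then (1 : ℝ) else 0))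
      1 := by
  intro ε hε
  refine ⟨fun x => if x = 0 then 1 else |x|, fun x _ => ?_, fun P hP => ⟨?_, ?_⟩⟩
  · dsimp only
    split_ifs with hx
    · exact one_pos
    · exact abs_pos.mpr hx
  · have hsum : intervalSumOn
        (fun u v => (if 0 < v then (1 : ℝ) else 0) - (if 0 < u then (1 : ℝ) else 0)) P
        (Set.Icc a b \ {0}) = 0 := by
      refine intervalSumOn_eq_zero fun i ⟨_, ht⟩ => ?_
      have hle := (P.mono i.castSucc_lt_succ).le
      have hl := hP i (Set.left_mem_Icc.mpr hle)
      have hr := hP i (Set.right_mem_Icc.mpr hle)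
      simp only [if_neg (show ¬ P.t i = 0 from ht), Set.mem_Ioo] at hl hr
      rcases lt_or_gt_of_ne (show P.t i ≠ 0 from ht) with h | h
      · rw [abs_of_neg h] at hl hr
        rw [if_neg (by linarith), if_neg (by linarith), sub_self]
      · rw [abs_of_pos h] at hl hr
        rw [if_pos (by linarith), if_pos (by linarith), sub_self]
    rw [hsum]
    simpa [riemannSum] using hε
  · rw [P.intervalSum_sub fun x => if 0 < x then (1 : ℝ) else 0,
      if_pos hb, if_neg ha.not_gt, sub_zero]
end

section
/- Let a < 0 < b and let F(x) = 1/x on [a,b] ∖ {0}, so that F is differentiable on [a,b] ∖ {0} with derivative f(x) = −1/x². Let D_exF : [a,b] → ℝ be given by D_exF(x) = −1/x² for x ≠ 0 and D_exF(0) = 0. Then D_exF is totally Kurzweil–Henstock integrable on [a,b] with KH-vt∫_a^b D_exF = (a−b)/(ab), the witnessing interval function being the associated interval function of F_ex, where F_ex(x) = 1/x for x ≠ 0 and F_ex(0) = 0. -/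
theorem Fin.sum_succ_sub_castSucc {n : ℕ} (g : Fin (n + 1) → ℝ) :
    ∑ i : Fin n, (g i.succ - g i.castSucc) = g (Fin.last n) - g 0 := by
  have h₁ := Fin.sum_univ_succ g
  have h₂ := Fin.sum_univ_castSucc g
  rw [Finset.sum_sub_distrib]
  linarith

/-- The straddle lemma. -/
theorem HasDerivAt.exists_straddle {F : ℝ → ℝ} {f' x η : ℝ} (h : HasDerivAt F f' x)
    (hη : 0 < η) :
    ∃ δ > 0, ∀ u v, u ≤ x → x ≤ v → x - δ < u → v < x + δ →
      |f' * (v - u) - (F v - F u)| ≤ η * (v - u) := by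
  obtain ⟨δ, hδ, hball⟩ := Metric.eventually_nhds_iff.1 (h.isLittleO.def hη)
  refine ⟨δ, hδ, fun u v hu hv hu' hv' => ?_⟩
  have h₁ := hball (y := u) (by rw [Real.dist_eq, abs_lt]; constructor <;> linarith)
  have h₂ := hball (y := v) (by rw [Real.dist_eq, abs_lt]; constructor <;> linarith)
  simp only [Real.norm_eq_abs, smul_eq_mul] at h₁ h₂
  rw [abs_of_nonpos (sub_nonpos.2 hu), abs_le] at h₁
  rw [abs_of_nonneg (sub_nonneg.2 hv), abs_le] at h₂
  rw [abs_le]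
  constructor <;> linarith [h₁.1, h₁.2, h₂.1, h₂.2]

/-- A function which is the derivative of `F` off `E` and vanishes on `E` is totally
Kurzweil–Henstock integrable to the increment of `F`. -/
theorem totalKHIntegralWith_of_hasDerivAt {a b : ℝ} {E : Set ℝ} {F f : ℝ → ℝ} (hab : a ≤ b)
    (hderiv : ∀ x ∈ Set.Icc a b \ E, HasDerivAt F (f x) x) (hzero : ∀ x ∈ E, f x = 0) :
    TotalKHIntegralWith a b E f (fun u v => F v - F u) (F b - F a) := by
  intro ε hε
  have hpos : 0 < b - a + 1 := by linarith
  have hη : 0 < ε / (b - a + 1) := div_pos hε hpos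
  have hδ : ∀ x, ∃ δ > 0, x ∈ Set.Icc a b \ E → ∀ u v, u ≤ x → x ≤ v → x - δ < u →
      v < x + δ → |f x * (v - u) - (F v - F u)| ≤ ε / (b - a + 1) * (v - u) := by
    intro x
    by_cases hx : x ∈ Set.Icc a b \ E
    · obtain ⟨δ, hδ, h⟩ := (hderiv x hx).exists_straddle hη
      exact ⟨δ, hδ, fun _ => h⟩
    · exact ⟨1, one_pos, fun h => absurd h hx⟩
  choose δ hδpos hδ using hδ
  refine ⟨δ, fun x _ => hδpos x, fun P hP => ⟨?_, ?_⟩⟩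
  · rw [riemannSum, intervalSumOn, ← Finset.sum_sub_distrib]
    refine (Finset.abs_sum_le_sum_abs _ _).trans_lt ((Finset.sum_le_sum
      (g := fun i => ε / (b - a + 1) * (P.c i.succ - P.c i.castSucc)) fun i _ => ?_).trans_lt ?_)
    · have hle : P.c i.castSucc ≤ P.c i.succ := (P.tag_mem i).1.trans (P.tag_mem i).2
      split_ifs with hi
      · exact hδ _ hi _ _ (P.tag_mem i).1 (P.tag_mem i).2
          (hP i (Set.left_mem_Icc.2 hle)).1 (hP i (Set.right_mem_Icc.2 hle)).2
      · have hE : P.t i ∈ E := by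
          by_contra h
          exact hi ⟨P.tag_mem_Icc i, h⟩
        rw [hzero _ hE, zero_mul, sub_zero, abs_zero]
        exact mul_nonneg hη.le (sub_nonneg.2 hle)
    · rw [← Finset.mul_sum, Fin.sum_succ_sub_castSucc, P.first, P.last, div_mul_eq_mul_div,
        div_lt_iff₀ hpos]
      nlinarith
  · rw [intervalSum, Fin.sum_succ_sub_castSucc (fun i => F (P.c i)), P.first, P.last]

open Classical in
/-- For `F x = 1/x` on `[a, b] \ {0}` with `a < 0 < b`, the function
`D_ex F` (equal to `-1/x²` for `x ≠ 0` and `0` at `0`) is totally Kurzweil–Henstock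
integrable on `[a, b]` to `(a - b) / (a * b)`, witnessed by the associated interval
function of `F_ex` (where `F_ex x = 1/x` for `x ≠ 0` and `F_ex 0 = 0`). -/
theorem one_div_totalKH (a b : ℝ) (ha : a < 0) (hb : 0 < b) :
    TotalKHIntegralWith a b {0}
      (fun x => if x = 0 then 0 else -(1 / x ^ 2))
      (fun u v => (if v = 0 then 0 else 1 / v) - (if u = 0 then 0 else 1 / u))
      ((a - b) / (a * b)) := by
  have h := totalKHIntegralWith_of_hasDerivAt (a := a) (b := b) (E := {0})
    (F := fun x => if x = 0 then 0 else 1 / x)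
    (f := fun x => if x = 0 then 0 else -(1 / x ^ 2)) (ha.trans hb).le
    (fun x hx => ?_) (fun x hx => if_pos hx)
  · have hval : (a - b) / (a * b) = 1 / b - 1 / a := by
      field_simp [ha.ne, hb.ne']
    simpa only [if_neg ha.ne, if_neg hb.ne', ← hval] using h
  · have hx0 : x ≠ 0 := hx.2
    have hinv : HasDerivAt (fun y : ℝ => y⁻¹) (-(1 / x ^ 2)) x := by
      simpa using hasDerivAt_inv hx0
    simp only [if_neg hx0]
    refine hinv.congr_of_eventuallyEq ?_
    filter_upwards [isOpen_ne.mem_nhds hx0] with y hy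
    rw [if_neg hy, one_div]
end
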